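/- Let p be an odd prime, N ≥ 1 an integer, κ ∈ {1,2,3}, and let s, a₁, a₂, c₁, c₂ be integers each coprime to p. Then it is impossible that all of the following hold: a₁c₁ ≡ κ·a₂c₂ (mod p^{2N}), κ·a₂c₂ ≡ −(a₁c₂ + a₂c₁) (mod p^{2N}), a₁ ≡ s·c₁ (mod p^N), and a₂ ≡ s·c₂ (mod p^N). -/

import Mathlib

/-- Modulo `9`, the form `x² + xy + y²` has no zero with `x` prime to `3`. -/
theorem Int.three_dvd_of_nine_dvd_sq_add_mul_add_sq {x y : ℤ}
    (h : (9 : ℤ) ∣ x ^ 2 + x * y + y ^ 2) : (3 : ℤ) ∣ x := by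
  have key : ∀ u v : ZMod 9, u ^ 2 + u * v + v ^ 2 = 0 → 3 * u = 0 := by decide
  have hz : ((x ^ 2 + x * y + y ^ 2 : ℤ) : ZMod 9) = 0 :=
    (ZMod.intCast_zmod_eq_zero_iff_dvd _ 9).2 h
  push_cast at hz
  have hx : ((3 * x : ℤ) : ZMod 9) = 0 := by
    push_cast
    exact key _ _ hz
  have := (ZMod.intCast_zmod_eq_zero_iff_dvd _ 9).1 hx
  omega

/-- If `aᵢ ≡ s cᵢ` modulo a prime `p`, the Cartan type `X₂` conditions modulo `p` force
`p ∣ κ (4 - κ)`. -/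
theorem Int.prime_dvd_mul_four_sub_of_modEq {p κ s a₁ a₂ c₁ c₂ : ℤ} (hp : Prime p)
    (hs : ¬ p ∣ s) (hc₂ : ¬ p ∣ c₂)
    (h₁ : a₁ * c₁ ≡ κ * (a₂ * c₂) [ZMOD p])
    (h₂ : κ * (a₂ * c₂) ≡ -(a₁ * c₂ + a₂ * c₁) [ZMOD p])
    (h₃ : a₁ ≡ s * c₁ [ZMOD p]) (h₄ : a₂ ≡ s * c₂ [ZMOD p]) : p ∣ κ * (4 - κ) := by
  obtain ⟨u, hu⟩ := h₁.dvd
  obtain ⟨v, hv⟩ := h₂.dvd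
  obtain ⟨x, hx⟩ := h₃.dvd
  obtain ⟨y, hy⟩ := h₄.dvd
  obtain rfl : a₁ = s * c₁ - p * x := by linarith
  obtain rfl : a₂ = s * c₂ - p * y := by linarith
  have hq : p ∣ s * (κ * c₂ ^ 2 - c₁ ^ 2) := ⟨u - x * c₁ + κ * y * c₂, by linear_combination hu⟩
  have hl : p ∣ s * c₂ * (κ * c₂ + 2 * c₁) :=
    ⟨x * c₂ + y * c₁ + κ * y * c₂ - v, by linear_combination -hv⟩
  have hq' := (hp.dvd_or_dvd hq).resolve_left hs
  have hl' := (hp.dvd_or_dvd hl).resolve_left fun h => (hp.dvd_or_dvd h).elim hs hc₂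
  have h : p ∣ κ * (4 - κ) * c₂ ^ 2 := by
    rw [show κ * (4 - κ) * c₂ ^ 2 = 4 * (κ * c₂ ^ 2 - c₁ ^ 2) -
      (κ * c₂ - 2 * c₁) * (κ * c₂ + 2 * c₁) by ring]
    exact dvd_sub (hq'.mul_left 4) (hl'.mul_left _)
  exact (hp.dvd_or_dvd h).resolve_right fun h => hc₂ (hp.dvd_of_dvd_pow h)

/-- Rank ≤ 1 for quasi-Hopf algebras over `ℤ/pⁿ` with associator `Φ_s`, `p ∤ s`: the Cartan
type `X₂` conditions together with `aᵢ ≡ s cᵢ (mod p^N)` are contradictory. -/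
theorem stmt13 (p : ℕ) (hp : p.Prime) (hodd : Odd p) (N : ℕ) (hN : 1 ≤ N)
    (κ : ℤ) (hκ : κ = 1 ∨ κ = 2 ∨ κ = 3)
    (s a₁ a₂ c₁ c₂ : ℤ)
    (hs : ¬ (p : ℤ) ∣ s)
    (ha₁ : ¬ (p : ℤ) ∣ a₁) (ha₂ : ¬ (p : ℤ) ∣ a₂)
    (hc₁ : ¬ (p : ℤ) ∣ c₁) (hc₂ : ¬ (p : ℤ) ∣ c₂) :
    ¬ (a₁ * c₁ ≡ κ * (a₂ * c₂) [ZMOD (p : ℤ) ^ (2 * N)] ∧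
       κ * (a₂ * c₂) ≡ -(a₁ * c₂ + a₂ * c₁) [ZMOD (p : ℤ) ^ (2 * N)] ∧
       a₁ ≡ s * c₁ [ZMOD (p : ℤ) ^ N] ∧
       a₂ ≡ s * c₂ [ZMOD (p : ℤ) ^ N]) := by
  rintro ⟨h₁, h₂, h₃, h₄⟩
  have hpZ : Prime (p : ℤ) := Nat.prime_iff_prime_int.1 hp
  have hpN : (p : ℤ) ∣ (p : ℤ) ^ N := dvd_pow_self _ (by omega)
  have hp2N : (p : ℤ) ∣ (p : ℤ) ^ (2 * N) := dvd_pow_self _ (by omega)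
  have hκp := Int.prime_dvd_mul_four_sub_of_modEq hpZ hs hc₂ (h₁.of_dvd hp2N) (h₂.of_dvd hp2N)
    (h₃.of_dvd hpN) (h₄.of_dvd hpN)
  have h3 (h : (p : ℤ) ∣ 3) : p = 3 :=
    (Nat.prime_dvd_prime_iff_eq hp Nat.prime_three).1 (by exact_mod_cast h)
  rcases hκ with rfl | rfl | rfl
  · obtain rfl := h3 (by simpa using hκp)
    have h9 : (9 : ℤ) ∣ ((3 : ℕ) : ℤ) ^ (2 * N) := by
      simpa using pow_dvd_pow (3 : ℤ) (show 2 ≤ 2 * N by omega)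
    obtain ⟨u, hu⟩ := (h₁.of_dvd h9).dvd
    obtain ⟨v, hv⟩ := (h₂.of_dvd h9).dvd
    have h : (9 : ℤ) ∣ a₁ * (c₁ ^ 2 + c₁ * c₂ + c₂ ^ 2) :=
      ⟨-u * c₁ - u * c₂ - v * c₂, by linear_combination -(c₁ + c₂) * hu - c₂ * hv⟩
    have hcop : IsCoprime (9 : ℤ) a₁ := by
      have := (hpZ.coprime_iff_not_dvd.2 ha₁).pow_left (m := 2)
      simpa using this
    exact hc₁ (Int.three_dvd_of_nine_dvd_sq_add_mul_add_sq (hcop.dvd_of_dvd_mul_left h))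
  · norm_num at hκp
    have h2 : p ∣ 2 := hp.dvd_of_dvd_pow (n := 2) (by exact_mod_cast hκp)
    obtain rfl := (Nat.prime_dvd_prime_iff_eq hp Nat.prime_two).1 h2
    exact absurd hodd (by decide)
  · obtain rfl := h3 (by simpa using hκp)
    have h : ((3 : ℕ) : ℤ) ∣ a₁ * c₁ :=
      (h₁.of_dvd hp2N).dvd_iff.2 (Dvd.intro _ rfl)
    exact (hpZ.dvd_or_dvd h).elim ha₁ hc₁
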